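/- Fix γ ∈ [−4, 0) and a measurable β : (0, π/2] → [0, ∞) with ∫₀^{π/2} θ² β(θ) dθ = 8/π, and for ε ∈ (0, 1] set β^ε(θ) = (π³/ε³) β(πθ/ε) for θ ∈ (0, ε/2]. Let f^ε, f : ℝ³ → [0, ∞) be integrable functions such that √(f^ε) → √f in L²_loc(ℝ³) as ε ↓ 0, and let ψ ∈ DS_c^∞. Then, as ε ↓ 0, ∫∫_{ℝ⁶} √(f^ε(v) f^ε(v∗)) ( |v−v∗|^γ ∫₀^{ε/2} β^ε(θ) ∫₀^{2π} ∇̄ψ(v, v∗, σ(θ,φ)) dφ dθ ) dv∗ dv converges to 2 ∫∫_{ℝ⁶} √(f(v) f(v∗)) (div_v − div_{v∗})[ |v−v∗|^{2+γ} Π[v−v∗] ((∇_v − ∇_{v∗})ψ)(v,v∗) ] dv∗ dv. -/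

import Mathlib

noncomputable section
open Real MeasureTheory Filter Topology
open scoped RealInnerProductSpace

abbrev E3 : Type := EuclideanSpace ℝ (Fin 3)

/-- Post-collision velocity `v' = (v+v∗)/2 + (|v−v∗|/2)σ`. -/
def vPost (v w σ : E3) : E3 := ((2 : ℝ)⁻¹) • (v + w) + (‖v - w‖ / 2) • σ

/-- Post-collision velocity `v∗' = (v+v∗)/2 − (|v−v∗|/2)σ`. -/
def vPostStar (v w σ : E3) : E3 := ((2 : ℝ)⁻¹) • (v + w) - (‖v - w‖ / 2) • σ

/-- Collision direction `σ(θ,φ) = cos θ·k + sin θ·(cos φ·h + sin φ·i)`. -/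
def sigmaDir (k h i : E3) (θ φ : ℝ) : E3 :=
  Real.cos θ • k + Real.sin θ • (Real.cos φ • h + Real.sin φ • i)

/-- Unit vector `k = (v − v∗)/|v − v∗|`. -/
def unitK (v w : E3) : E3 := ‖v - w‖⁻¹ • (v - w)

/-- Orthogonal projection `Π[z]u = u − ⟨z,u⟩z/|z|²` onto the plane orthogonal to `z`. -/
def projPerp (z u : E3) : E3 := u - ((‖z‖ ^ 2)⁻¹ * ⟪z, u⟫) • z

/-- `(div_v − div_{v∗}) F` for a vector field `F : ℝ³ × ℝ³ → ℝ³`. -/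
def divDiff (F : E3 × E3 → E3) (v w : E3) : ℝ :=
  LinearMap.trace ℝ E3 ((fderiv ℝ (fun z => F (z, w)) v : E3 →L[ℝ] E3) : E3 →ₗ[ℝ] E3)
    - LinearMap.trace ℝ E3 ((fderiv ℝ (fun z => F (v, z)) w : E3 →L[ℝ] E3) : E3 →ₗ[ℝ] E3)

/-- `(∇_v − ∇_{v∗})ψ` for a scalar function `ψ : ℝ³ × ℝ³ → ℝ`. -/
def gradDiff (ψ : E3 × E3 → ℝ) (q : E3 × E3) : E3 :=
  gradient (fun z => ψ (z, q.2)) q.1 - gradient (fun z => ψ (q.1, z)) q.2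

/-- Discrete gradient `∇̄ψ(v,v∗,σ) = ψ(v',v∗') + ψ(v∗',v') − ψ(v,v∗) − ψ(v∗,v)` for a
function of two velocities. -/
def barGrad2 (ψ : E3 × E3 → ℝ) (v w σ : E3) : ℝ :=
  ψ (vPost v w σ, vPostStar v w σ) + ψ (vPostStar v w σ, vPost v w σ) - ψ (v, w) - ψ (w, v)


/-- Second order Taylor expansion with Lagrange remainder. -/
lemma exists_taylor_two {p p1 p2 : ℝ → ℝ} (hp : ∀ x, HasDerivAt p (p1 x) x)
    (hp1 : ∀ x, HasDerivAt p1 (p2 x) x) {t : ℝ} (ht : 0 < t) :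
    ∃ ξ ∈ Set.Ioo 0 t, p t - p 0 - t * p1 0 = p2 ξ / 2 * t ^ 2 := by
  have hr : ∀ x, HasDerivAt (fun x => p x - p 0 - x * p1 0) (p1 x - p1 0) x := fun x => by
    simpa using! ((hp x).sub_const (p 0)).sub ((hasDerivAt_id x).mul_const (p1 0))
  have hs : ∀ x : ℝ, HasDerivAt (fun x : ℝ => x ^ 2) (2 * x) x := fun x => by
    simpa using hasDerivAt_pow 2 x
  obtain ⟨c, hc, hc'⟩ := exists_ratio_hasDerivAt_eq_ratio_slope _ _ ht
    (fun x _ => (hr x).continuousAt.continuousWithinAt) (fun x _ => hr x) _ _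
    (fun x _ => (hs x).continuousAt.continuousWithinAt) (fun x _ => hs x)
  obtain ⟨ξ, hξ, hξ'⟩ := exists_hasDerivAt_eq_slope _ _ hc.1
    (fun x _ => (hp1 x).continuousAt.continuousWithinAt) (fun x _ => hp1 x)
  have hc0 : c ≠ 0 := hc.1.ne'
  refine ⟨ξ, ⟨hξ.1, hξ.2.trans hc.2⟩, ?_⟩
  rw [eq_div_iff (by simpa using hc0)] at hξ'
  apply mul_right_cancel₀ hc0
  linear_combination (-1 / 2 : ℝ) * hc' - t ^ 2 / 2 * hξ'

section Arc

variable {V : Type*} [NormedAddCommGroup V] [NormedSpace ℝ V]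

lemma hasDerivAt_arc (m a b : V) (t : ℝ) :
    HasDerivAt (fun t : ℝ => m + cos t • a + sin t • b) (-sin t • a + cos t • b) t :=
  (((hasDerivAt_cos t).smul_const a).const_add m).add ((hasDerivAt_sin t).smul_const b)

lemma hasDerivAt_arc' (a b : V) (t : ℝ) :
    HasDerivAt (fun t : ℝ => -sin t • a + cos t • b) (-cos t • a + -sin t • b) t :=
  ((hasDerivAt_sin t).neg.smul_const a).add ((hasDerivAt_cos t).smul_const b)

/-- Second derivative of `ψ` along the arc `t ↦ m + cos t • a + sin t • b`. -/
def arcDeriv₂ (ψ : V → ℝ) (m a b : V) (t : ℝ) : ℝ :=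
  fderiv ℝ (fderiv ℝ ψ) (m + cos t • a + sin t • b) (-sin t • a + cos t • b)
      (-sin t • a + cos t • b) +
    fderiv ℝ ψ (m + cos t • a + sin t • b) (-cos t • a + -sin t • b)

variable {ψ : V → ℝ}

lemma exists_bound_fderiv (hψ : ContDiff ℝ 2 ψ) (hψc : HasCompactSupport ψ) :
    ∃ M, (∀ x, ‖fderiv ℝ ψ x‖ ≤ M) ∧ ∀ x, ‖fderiv ℝ (fderiv ℝ ψ) x‖ ≤ M := by
  have h1 : ContDiff ℝ 1 (fderiv ℝ ψ) := hψ.fderiv_right (by norm_num)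
  have h2 : Continuous (fderiv ℝ (fderiv ℝ ψ)) := h1.continuous_fderiv (by norm_num)
  have hc : HasCompactSupport (fderiv ℝ ψ) := hψc.fderiv ℝ
  have hb1 : ∃ M, ∀ x, ‖fderiv ℝ ψ x‖ ≤ M :=
    HasCompactSupport.exists_bound_of_continuous (f := fderiv ℝ ψ) hc h1.continuous
  have hb2 : ∃ M, ∀ x, ‖fderiv ℝ (fderiv ℝ ψ) x‖ ≤ M :=
    HasCompactSupport.exists_bound_of_continuous (f := fderiv ℝ (fderiv ℝ ψ)) (hc.fderiv ℝ) h2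
  obtain ⟨M₁, hM₁⟩ := hb1
  obtain ⟨M₂, hM₂⟩ := hb2
  exact ⟨max M₁ M₂, fun x => (hM₁ x).trans (le_max_left _ _),
    fun x => (hM₂ x).trans (le_max_right _ _)⟩

lemma hasDerivAt_comp_arc (hψ : ContDiff ℝ 2 ψ) (m a b : V) (t : ℝ) :
    HasDerivAt (fun t : ℝ => ψ (m + cos t • a + sin t • b))
      (fderiv ℝ ψ (m + cos t • a + sin t • b) (-sin t • a + cos t • b)) t :=
  ((hψ.differentiable (by norm_num)) _).hasFDerivAt.comp_hasDerivAt t (hasDerivAt_arc m a b t)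

lemma hasDerivAt_fderiv_comp_arc (hψ : ContDiff ℝ 2 ψ) (m a b : V) (t : ℝ) :
    HasDerivAt (fun t : ℝ => fderiv ℝ ψ (m + cos t • a + sin t • b) (-sin t • a + cos t • b))
      (arcDeriv₂ ψ m a b t) t := by
  have h1 : ContDiff ℝ 1 (fderiv ℝ ψ) := hψ.fderiv_right (by norm_num)
  exact (((h1.differentiable (by norm_num)) _).hasFDerivAt.comp_hasDerivAt t
    (hasDerivAt_arc m a b t)).clm_apply (hasDerivAt_arc' a b t)

lemma continuous_arcDeriv₂ (hψ : ContDiff ℝ 2 ψ) (m a b : V) :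
    Continuous (arcDeriv₂ ψ m a b) := by
  have h1 : ContDiff ℝ 1 (fderiv ℝ ψ) := hψ.fderiv_right (by norm_num)
  have h2 : Continuous (fderiv ℝ (fderiv ℝ ψ)) := h1.continuous_fderiv (by norm_num)
  have h3 := h1.continuous
  have hc := continuous_cos
  have hs := continuous_sin
  unfold arcDeriv₂
  fun_prop

lemma norm_cos_smul_add_sin_smul_le (a b : V) (t : ℝ) :
    ‖cos t • a + sin t • b‖ ≤ ‖a‖ + ‖b‖ := by
  refine (norm_add_le _ _).trans ?_
  rw [norm_smul, norm_smul]
  exact add_le_add (mul_le_of_le_one_left (norm_nonneg _) (abs_cos_le_one t))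
    (mul_le_of_le_one_left (norm_nonneg _) (abs_sin_le_one t))

lemma abs_arcDeriv₂_le {M : ℝ} (h1 : ∀ x, ‖fderiv ℝ ψ x‖ ≤ M)
    (h2 : ∀ x, ‖fderiv ℝ (fderiv ℝ ψ) x‖ ≤ M) (m a b : V) (t : ℝ) :
    |arcDeriv₂ ψ m a b t| ≤ M * (‖a‖ + ‖b‖) ^ 2 + M * (‖a‖ + ‖b‖) := by
  have hM : 0 ≤ M := (norm_nonneg _).trans (h1 0)
  have hd1 : ‖-sin t • a + cos t • b‖ ≤ ‖a‖ + ‖b‖ := by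
    simpa [add_comm] using norm_cos_smul_add_sin_smul_le b (-a) t
  have hd2 : ‖-cos t • a + -sin t • b‖ ≤ ‖a‖ + ‖b‖ := by
    simpa using norm_cos_smul_add_sin_smul_le (-a) (-b) t
  refine (abs_add_le _ _).trans (add_le_add ?_ ?_)
  · refine ((fderiv ℝ (fderiv ℝ ψ) _).le_opNorm₂ _ _).trans ?_
    rw [sq, ← mul_assoc]
    gcongr
    exact h2 _
  · refine ((fderiv ℝ ψ _).le_opNorm _).trans ?_
    gcongr
    exact h1 _

/-- Increment of `ψ` integrated over the circle of the sphere at angle `t` from `a`. -/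
def circleIncr (ψ : V → ℝ) (m a H I : V) (t : ℝ) : ℝ :=
  ∫ φ in Set.Ioc (0 : ℝ) (2 * π), (ψ (m + cos t • a + sin t • (cos φ • H + sin φ • I)) - ψ (m + a))

lemma setIntegral_clm_circle (L : V →L[ℝ] ℝ) (H I : V) :
    ∫ φ in Set.Ioc (0 : ℝ) (2 * π), L (cos φ • H + sin φ • I) = 0 := by
  have hc := continuous_cos
  have hs := continuous_sin
  rw [← intervalIntegral.integral_of_le two_pi_pos.le]
  simp only [map_add, map_smul, smul_eq_mul]
  rw [intervalIntegral.integral_add (by apply Continuous.intervalIntegrable; fun_prop)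
    (by apply Continuous.intervalIntegrable; fun_prop)]
  simp

lemma setIntegral_bilin_circle (B : V →L[ℝ] V →L[ℝ] ℝ) (H I : V) :
    ∫ φ in Set.Ioc (0 : ℝ) (2 * π), B (cos φ • H + sin φ • I) (cos φ • H + sin φ • I) =
      π * (B H H + B I I) := by
  have hc := continuous_cos
  have hs := continuous_sin
  rw [← intervalIntegral.integral_of_le two_pi_pos.le]
  have : ∀ φ : ℝ, B (cos φ • H + sin φ • I) (cos φ • H + sin φ • I) =
      cos φ ^ 2 * B H H + (sin φ ^ 2 * B I I + sin φ * cos φ * (B H I + B I H)) := fun φ => by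
    simp; ring
  simp only [this]
  rw [intervalIntegral.integral_add (by apply Continuous.intervalIntegrable; fun_prop)
    (by apply Continuous.intervalIntegrable; fun_prop),
    intervalIntegral.integral_add (by apply Continuous.intervalIntegrable; fun_prop)
    (by apply Continuous.intervalIntegrable; fun_prop)]
  simp [integral_cos_sq, integral_sin_sq, integral_sin_mul_cos₁]
  ring

lemma circleIncr_eq (hψ : Continuous ψ) (m a H I : V) (t : ℝ) :
    circleIncr ψ m a H I t = ∫ φ in Set.Ioc (0 : ℝ) (2 * π),
      (ψ (m + cos t • a + sin t • (cos φ • H + sin φ • I)) - ψ (m + a)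
        - t * fderiv ℝ ψ (m + a) (cos φ • H + sin φ • I)) := by
  have hc := continuous_cos
  have hs := continuous_sin
  rw [integral_sub, integral_const_mul, setIntegral_clm_circle, mul_zero, sub_zero, circleIncr]
  · exact Continuous.integrableOn_Ioc (by fun_prop)
  · exact Continuous.integrableOn_Ioc (by fun_prop)

lemma circle_remainder (hψ : ContDiff ℝ 2 ψ) (m a b : V) {t : ℝ} (ht : 0 < t) :
    ∃ ξ ∈ Set.Ioo 0 t, ψ (m + cos t • a + sin t • b) - ψ (m + a) - t * fderiv ℝ ψ (m + a) b
      = arcDeriv₂ ψ m a b ξ / 2 * t ^ 2 := by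
  simpa using exists_taylor_two (hasDerivAt_comp_arc hψ m a b)
    (hasDerivAt_fderiv_comp_arc hψ m a b) ht

lemma abs_circle_remainder_le (hψ : ContDiff ℝ 2 ψ) {M : ℝ} (h1 : ∀ x, ‖fderiv ℝ ψ x‖ ≤ M)
    (h2 : ∀ x, ‖fderiv ℝ (fderiv ℝ ψ) x‖ ≤ M) {m a H I : V} {K : ℝ}
    (hK : ‖a‖ + (‖H‖ + ‖I‖) ≤ K) {t : ℝ} (ht : 0 < t) (φ : ℝ) :
    |ψ (m + cos t • a + sin t • (cos φ • H + sin φ • I)) - ψ (m + a)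
        - t * fderiv ℝ ψ (m + a) (cos φ • H + sin φ • I)| ≤ (M * K ^ 2 + M * K) / 2 * t ^ 2 := by
  have hM : 0 ≤ M := (norm_nonneg _).trans (h1 0)
  obtain ⟨ξ, -, hξ⟩ := circle_remainder hψ m a (cos φ • H + sin φ • I) ht
  rw [hξ, abs_mul, abs_div, abs_of_pos (two_pos : (0 : ℝ) < 2), abs_of_nonneg (sq_nonneg t)]
  have hK' : ‖a‖ + ‖cos φ • H + sin φ • I‖ ≤ K :=
    (add_le_add_right (norm_cos_smul_add_sin_smul_le H I φ) _).trans hK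
  have := abs_arcDeriv₂_le h1 h2 m a (cos φ • H + sin φ • I) ξ
  gcongr
  refine this.trans ?_
  gcongr

lemma abs_circleIncr_le (hψ : ContDiff ℝ 2 ψ) {M : ℝ} (h1 : ∀ x, ‖fderiv ℝ ψ x‖ ≤ M)
    (h2 : ∀ x, ‖fderiv ℝ (fderiv ℝ ψ) x‖ ≤ M) {m a H I : V} {K : ℝ}
    (hK : ‖a‖ + (‖H‖ + ‖I‖) ≤ K) {t : ℝ} (ht : 0 < t) :
    |circleIncr ψ m a H I t| ≤ π * (M * K ^ 2 + M * K) * t ^ 2 := by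
  rw [circleIncr_eq hψ.continuous, ← norm_eq_abs]
  refine (norm_setIntegral_le_of_norm_le_const (C := (M * K ^ 2 + M * K) / 2 * t ^ 2)
    measure_Ioc_lt_top fun φ _ => ?_).trans (le_of_eq ?_)
  · exact abs_circle_remainder_le hψ h1 h2 hK ht φ
  simp [Measure.real, pi_pos.le]
  ring

lemma tendsto_circleIncr (hψ : ContDiff ℝ 2 ψ) {M : ℝ} (h1 : ∀ x, ‖fderiv ℝ ψ x‖ ≤ M)
    (h2 : ∀ x, ‖fderiv ℝ (fderiv ℝ ψ) x‖ ≤ M) (m a H I : V) :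
    Tendsto (fun t => circleIncr ψ m a H I t / t ^ 2) (𝓝[>] 0)
      (𝓝 (π / 2 * (fderiv ℝ (fderiv ℝ ψ) (m + a) H H + fderiv ℝ (fderiv ℝ ψ) (m + a) I I
        - 2 * fderiv ℝ ψ (m + a) a))) := by
  have hc := continuous_cos
  have hs := continuous_sin
  have hψc := hψ.continuous
  have key : Tendsto (fun t : ℝ => ∫ φ in Set.Ioc (0 : ℝ) (2 * π),
      (ψ (m + cos t • a + sin t • (cos φ • H + sin φ • I)) - ψ (m + a)
        - t * fderiv ℝ ψ (m + a) (cos φ • H + sin φ • I)) / t ^ 2) (𝓝[>] 0)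
      (𝓝 (∫ φ in Set.Ioc (0 : ℝ) (2 * π),
        arcDeriv₂ ψ m a (cos φ • H + sin φ • I) 0 / 2)) := by
    refine tendsto_integral_filter_of_dominated_convergence
      (fun _ => (M * (‖a‖ + (‖H‖ + ‖I‖)) ^ 2 + M * (‖a‖ + (‖H‖ + ‖I‖))) / 2) ?_ ?_ ?_ ?_
    · exact Eventually.of_forall fun t => Continuous.aestronglyMeasurable (by fun_prop)
    · filter_upwards [self_mem_nhdsWithin] with t ht
      refine Eventually.of_forall fun φ => ?_
      have ht' : (0 : ℝ) < t := ht
      rw [norm_eq_abs, abs_div, abs_of_pos (pow_pos ht' 2), div_le_iff₀ (pow_pos ht' 2)]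
      exact abs_circle_remainder_le hψ h1 h2 le_rfl ht φ
    · exact integrable_const _
    · refine Eventually.of_forall fun φ => ?_
      have hξ : ∀ t : ℝ, ∃ ξ, 0 < t → ξ ∈ Set.Ioo 0 t ∧
          ψ (m + cos t • a + sin t • (cos φ • H + sin φ • I)) - ψ (m + a)
            - t * fderiv ℝ ψ (m + a) (cos φ • H + sin φ • I)
          = arcDeriv₂ ψ m a (cos φ • H + sin φ • I) ξ / 2 * t ^ 2 := fun t => by
        by_cases ht : 0 < t
        · obtain ⟨ξ, hξ⟩ := circle_remainder hψ m a (cos φ • H + sin φ • I) ht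
          exact ⟨ξ, fun _ => hξ⟩
        · exact ⟨0, fun h => absurd h ht⟩
      choose ξ hξ using hξ
      have hξ0 : Tendsto ξ (𝓝[>] 0) (𝓝 0) := by
        refine tendsto_of_tendsto_of_tendsto_of_le_of_le' tendsto_const_nhds
          (tendsto_id.mono_left nhdsWithin_le_nhds) ?_ ?_
        · filter_upwards [self_mem_nhdsWithin] with t ht using (hξ t ht).1.1.le
        · filter_upwards [self_mem_nhdsWithin] with t ht using (hξ t ht).1.2.le
      have := ((((continuous_arcDeriv₂ hψ m a (cos φ • H + sin φ • I)).tendsto 0).comp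
        hξ0).div_const 2)
      refine this.congr' ?_
      filter_upwards [self_mem_nhdsWithin] with t ht
      have ht' : (0 : ℝ) < t := ht
      rw [(hξ t ht).2, mul_div_assoc, div_self (pow_pos ht' 2).ne', mul_one, Function.comp_apply]
  have hlim : ∫ φ in Set.Ioc (0 : ℝ) (2 * π), arcDeriv₂ ψ m a (cos φ • H + sin φ • I) 0 / 2 =
      π / 2 * (fderiv ℝ (fderiv ℝ ψ) (m + a) H H + fderiv ℝ (fderiv ℝ ψ) (m + a) I I
        - 2 * fderiv ℝ ψ (m + a) a) := by
    have : ∀ φ : ℝ, arcDeriv₂ ψ m a (cos φ • H + sin φ • I) 0 =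
        fderiv ℝ (fderiv ℝ ψ) (m + a) (cos φ • H + sin φ • I) (cos φ • H + sin φ • I)
          - fderiv ℝ ψ (m + a) a := fun φ => by
      simp only [arcDeriv₂, sin_zero, cos_zero, neg_zero, zero_smul, one_smul, add_zero, zero_add,
        neg_smul, map_neg]
      ring
    simp only [this]
    rw [integral_div, integral_sub _ (integrable_const _), setIntegral_bilin_circle]
    · simp [Measure.real, pi_pos.le]
      ring
    · exact Continuous.integrableOn_Ioc (by fun_prop)
  rw [hlim] at key
  refine key.congr fun t => ?_
  rw [integral_div, ← circleIncr_eq hψc]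

end Arc

section PairIntegral

variable {X ι : Type*} [MeasurableSpace X] {μ : Measure X} [IsFiniteMeasure μ] {l : Filter ι}

/-- On a finite measure space, convergence to zero in `L²` implies convergence to zero in `L¹`. -/
lemma tendsto_integral_abs_of_tendsto_integral_sq {d : ι → X → ℝ}
    (hd : ∀ᶠ n in l, Integrable (d n) μ) (hd2 : ∀ᶠ n in l, Integrable (fun x => d n x ^ 2) μ)
    (h : Tendsto (fun n => ∫ x, d n x ^ 2 ∂μ) l (𝓝 0)) :
    Tendsto (fun n => ∫ x, |d n x| ∂μ) l (𝓝 0) := by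
  have hsq : Tendsto (fun n => √(μ.real Set.univ * ∫ x, d n x ^ 2 ∂μ)) l (𝓝 0) := by
    simpa using (h.const_mul (μ.real Set.univ)).sqrt
  refine squeeze_zero' (Eventually.of_forall fun n => integral_nonneg fun x => abs_nonneg _) ?_ hsq
  filter_upwards [hd, hd2] with n h1 h2
  apply Real.le_sqrt_of_sq_le
  set D := ∫ x, |d n x| ∂μ
  set S := ∫ x, d n x ^ 2 ∂μ
  have hpos : ∀ t : ℝ, 0 ≤ μ.real Set.univ * (t * t) + (-2 * D) * t + S := fun t => by
    have : 0 ≤ ∫ x, (t - |d n x|) ^ 2 ∂μ := integral_nonneg fun x => sq_nonneg _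
    have e : ∫ x, (t - |d n x|) ^ 2 ∂μ = ∫ x, (t * t + ((-2 * t) * |d n x| + d n x ^ 2)) ∂μ := by
      congr 1
      ext x
      rw [← sq_abs (d n x)]
      ring
    have h12 : Integrable (fun x => -2 * t * |d n x| + d n x ^ 2) μ :=
      (h1.abs.const_mul _).add h2
    rw [e, integral_add (integrable_const _) h12,
      integral_add (h1.abs.const_mul _) h2, integral_const_mul (-2 * t), integral_const] at this
    simp only [smul_eq_mul] at this
    linarith
  have := discrim_le_zero hpos
  rw [discrim] at this
  linarith

variable [l.IsCountablyGenerated]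

/-- Strong `L¹` convergence of tensor products paired with bounded pointwise convergence. -/
lemma tendsto_integral_prod_mul_of_tendsto {x : ι → X → ℝ} {x₀ : X → ℝ}
    (hx : ∀ᶠ n in l, Integrable (x n) μ) (hx₀ : Integrable x₀ μ)
    (hlim : Tendsto (fun n => ∫ y, |x n y - x₀ y| ∂μ) l (𝓝 0))
    {A : ι → X × X → ℝ} {A₀ : X × X → ℝ} {C : ℝ}
    (hA : ∀ᶠ n in l, AEStronglyMeasurable (A n) (μ.prod μ))
    (hAC : ∀ᶠ n in l, ∀ q, |A n q| ≤ C) (hA₀ : ∀ q, Tendsto (fun n => A n q) l (𝓝 (A₀ q))) :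
    Tendsto (fun n => ∫ q, x n q.1 * x n q.2 * A n q ∂(μ.prod μ)) l
      (𝓝 (∫ q, x₀ q.1 * x₀ q.2 * A₀ q ∂(μ.prod μ))) := by
  have hxx : Integrable (fun q : X × X => x₀ q.1 * x₀ q.2) (μ.prod μ) := hx₀.mul_prod hx₀
  have h1 : Tendsto (fun n => ∫ q, x₀ q.1 * x₀ q.2 * A n q ∂(μ.prod μ)) l
      (𝓝 (∫ q, x₀ q.1 * x₀ q.2 * A₀ q ∂(μ.prod μ))) := by
    refine tendsto_integral_filter_of_dominated_convergence
      (fun q => |x₀ q.1 * x₀ q.2| * C) ?_ ?_ (hxx.abs.mul_const C) ?_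
    · filter_upwards [hA] with n hn using hxx.aestronglyMeasurable.mul hn
    · filter_upwards [hAC] with n hn
      refine Eventually.of_forall fun q => ?_
      rw [norm_mul, norm_eq_abs, norm_eq_abs]
      gcongr
      exact hn q
    · exact Eventually.of_forall fun q => (hA₀ q).const_mul _
  have h2 : Tendsto (fun n => ∫ q, (x n q.1 * x n q.2 - x₀ q.1 * x₀ q.2) * A n q ∂(μ.prod μ)) l
      (𝓝 0) := by
    have hb : Tendsto (fun n => ((∫ y, |x n y - x₀ y| ∂μ) * (∫ y, |x n y - x₀ y| ∂μ)
        + ((∫ y, |x n y - x₀ y| ∂μ) * (∫ y, |x₀ y| ∂μ)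
          + (∫ y, |x₀ y| ∂μ) * (∫ y, |x n y - x₀ y| ∂μ))) * C) l (𝓝 0) := by
      simpa using ((hlim.mul hlim).add ((hlim.mul_const (∫ y, |x₀ y| ∂μ)).add
        (hlim.const_mul (∫ y, |x₀ y| ∂μ)))).mul_const C
    refine squeeze_zero_norm' ?_ hb
    filter_upwards [hx, hAC] with n hn hC
    have hd : Integrable (fun y => |x n y - x₀ y|) μ := (hn.sub hx₀).abs
    have i1 := hd.mul_prod hd
    have i2 := hd.mul_prod hx₀.abs
    have i3 := hx₀.abs.mul_prod hd
    have i23 : Integrable (fun q : X × X =>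
        |x n q.1 - x₀ q.1| * |x₀ q.2| + |x₀ q.1| * |x n q.2 - x₀ q.2|) (μ.prod μ) := i2.add i3
    rw [← integral_prod_mul, ← integral_prod_mul, ← integral_prod_mul, ← integral_add i2 i3,
      ← integral_add i1 i23, ← integral_mul_const]
    refine norm_integral_le_of_norm_le ((i1.add i23).mul_const C)
      (Eventually.of_forall fun q => ?_)
    rw [norm_mul, norm_eq_abs, norm_eq_abs]
    refine mul_le_mul ?_ (hC q) (abs_nonneg _) (by positivity)
    have e : x n q.1 * x n q.2 - x₀ q.1 * x₀ q.2 = (x n q.1 - x₀ q.1) * (x n q.2 - x₀ q.2)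
        + ((x n q.1 - x₀ q.1) * x₀ q.2 + x₀ q.1 * (x n q.2 - x₀ q.2)) := by ring
    rw [e]
    refine (abs_add_le _ _).trans (add_le_add (abs_mul _ _).le ((abs_add_le _ _).trans ?_))
    rw [abs_mul, abs_mul]
  have h3 := h2.add h1
  rw [zero_add] at h3
  refine h3.congr' ?_
  filter_upwards [hx, hA, hAC] with n hn hm hC
  have hnn : Integrable (fun q : X × X => x n q.1 * x n q.2) (μ.prod μ) := hn.mul_prod hn
  rw [← integral_add]
  · congr 1
    ext q
    ring
  · exact (hnn.sub hxx).mul_bdd hm (Eventually.of_forall hC)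
  · exact hxx.mul_bdd hm (Eventually.of_forall hC)

end PairIntegral

section Scaling

lemma rescaled_kernel_eq {β : ℝ → ℝ} {g : ℝ → ℝ} {ε : ℝ} (hε : 0 < ε) :
    ∫ θ in Set.Ioc (0:ℝ) (ε / 2), (π ^ 3 / ε ^ 3) * β (π * θ / ε) * g θ =
      ∫ s in Set.Ioc (0:ℝ) (π / 2), s ^ 2 * β s * (g (ε / π * s) / (ε / π * s) ^ 2) := by
  have hπ := pi_pos
  rw [← intervalIntegral.integral_of_le (by positivity),
    ← intervalIntegral.integral_of_le (by positivity)]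
  have h := intervalIntegral.integral_comp_mul_left (a := 0) (b := π / 2) (c := ε / π)
    (fun θ => (π ^ 3 / ε ^ 3) * β (π * θ / ε) * g θ) (by positivity)
  have e1 : ε / π * (π / 2) = ε / 2 := by field_simp
  rw [mul_zero, e1, eq_inv_smul_iff₀ (by positivity), smul_eq_mul,
    ← intervalIntegral.integral_const_mul] at h
  rw [← h]
  refine intervalIntegral.integral_congr_ae (Eventually.of_forall fun s hs => ?_)
  rw [Set.uIoc_of_le (by positivity)] at hs
  have hs0 : 0 < s := hs.1
  have e2 : π * (ε / π * s) / ε = s := by field_simp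
  rw [e2]
  field_simp

/-- Integrating a function that is quadratic at zero against the rescaled kernel. -/
lemma tendsto_rescaled_kernel {β : ℝ → ℝ} (hβm : Measurable β)
    (hβi : IntegrableOn (fun θ => θ ^ 2 * β θ) (Set.Ioc 0 (π / 2)))
    {g : ℝ → ℝ} {K G : ℝ} (hgm : Measurable g) (hgK : ∀ t, 0 < t → |g t| ≤ K * t ^ 2)
    (hg : Tendsto (fun t => g t / t ^ 2) (𝓝[>] 0) (𝓝 G)) :
    Tendsto (fun ε : ℝ => ∫ θ in Set.Ioc (0:ℝ) (ε / 2), (π ^ 3 / ε ^ 3) * β (π * θ / ε) * g θ)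
      (𝓝[>] 0) (𝓝 ((∫ θ in Set.Ioc (0:ℝ) (π / 2), θ ^ 2 * β θ) * G)) := by
  have hπ := pi_pos
  have hscale : ∀ s : ℝ, 0 < s → Tendsto (fun ε : ℝ => ε / π * s) (𝓝[>] 0) (𝓝[>] 0) := fun s hs => by
    refine tendsto_nhdsWithin_iff.2 ⟨?_, ?_⟩
    · have : Continuous fun ε : ℝ => ε / π * s := by fun_prop
      simpa using (this.tendsto 0).mono_left nhdsWithin_le_nhds
    · filter_upwards [self_mem_nhdsWithin] with ε hε
      have hε' : (0 : ℝ) < ε := hε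
      exact (by positivity : 0 < ε / π * s)
  have key : Tendsto (fun ε : ℝ => ∫ s in Set.Ioc (0:ℝ) (π / 2),
      s ^ 2 * β s * (g (ε / π * s) / (ε / π * s) ^ 2)) (𝓝[>] 0)
      (𝓝 (∫ s in Set.Ioc (0:ℝ) (π / 2), s ^ 2 * β s * G)) := by
    refine tendsto_integral_filter_of_dominated_convergence
      (fun s => |s ^ 2 * β s| * K) ?_ ?_ (hβi.abs.mul_const K) ?_
    · exact Eventually.of_forall fun ε => Measurable.aestronglyMeasurable (by fun_prop)
    · filter_upwards [self_mem_nhdsWithin] with ε hε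
      have hε' : (0 : ℝ) < ε := hε
      filter_upwards [ae_restrict_mem measurableSet_Ioc] with s hs
      have hs0 : 0 < s := hs.1
      rw [norm_mul, norm_eq_abs, norm_eq_abs, abs_div, abs_of_nonneg (sq_nonneg (ε / π * s))]
      gcongr
      rw [div_le_iff₀ (by positivity)]
      exact hgK _ (by positivity)
    · filter_upwards [ae_restrict_mem measurableSet_Ioc] with s hs
      exact (hg.comp (hscale s hs.1)).const_mul _
  rw [integral_mul_const] at key
  refine key.congr' ?_
  filter_upwards [self_mem_nhdsWithin] with ε hε
  exact (rescaled_kernel_eq hε).symm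

/-- The rescaled kernel integrated against a quadratically small function is bounded. -/
lemma abs_rescaled_kernel_le {β : ℝ → ℝ} (hβ0 : ∀ θ, 0 ≤ β θ)
    (hβi : IntegrableOn (fun θ => θ ^ 2 * β θ) (Set.Ioc 0 (π / 2)))
    {g : ℝ → ℝ} {K : ℝ} (hgK : ∀ t, 0 < t → |g t| ≤ K * t ^ 2) {ε : ℝ} (hε : 0 < ε) :
    |∫ θ in Set.Ioc (0:ℝ) (ε / 2), (π ^ 3 / ε ^ 3) * β (π * θ / ε) * g θ| ≤
      (∫ θ in Set.Ioc (0:ℝ) (π / 2), θ ^ 2 * β θ) * K := by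
  have hπ := pi_pos
  rw [rescaled_kernel_eq hε, ← integral_mul_const, ← norm_eq_abs]
  refine norm_integral_le_of_norm_le (hβi.mul_const K) ?_
  filter_upwards [ae_restrict_mem measurableSet_Ioc] with s hs
  have hs0 : 0 < s := hs.1
  have hb : 0 ≤ s ^ 2 * β s := mul_nonneg (sq_nonneg s) (hβ0 s)
  rw [norm_mul, norm_eq_abs, norm_eq_abs, abs_of_nonneg hb, abs_div,
    abs_of_nonneg (sq_nonneg (ε / π * s))]
  gcongr
  rw [div_le_iff₀ (by positivity)]
  exact hgK _ (by positivity)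


end Scaling

section Geometry

lemma unitK_smul_norm (v w : E3) : ‖v - w‖ • unitK v w = v - w := by
  rcases eq_or_ne v w with rfl | hvw
  · simp
  · rw [unitK, smul_smul, mul_inv_cancel₀ (norm_ne_zero_iff.2 (sub_ne_zero.2 hvw)), one_smul]

lemma norm_unitK {v w : E3} (hvw : v ≠ w) : ‖unitK v w‖ = 1 := by
  rw [unitK, norm_smul, norm_inv, norm_norm,
    inv_mul_cancel₀ (norm_ne_zero_iff.2 (sub_ne_zero.2 hvw))]

lemma barGrad2_sigmaDir {ψ : E3 × E3 → ℝ} (hψsymm : ∀ v w : E3, ψ (v, w) = ψ (w, v))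
    (v w h i : E3) (θ φ : ℝ) :
    barGrad2 ψ v w (sigmaDir (unitK v w) h i θ φ) =
      2 * (ψ (((2 : ℝ)⁻¹ • (v + w), (2 : ℝ)⁻¹ • (v + w))
          + cos θ • ((2 : ℝ)⁻¹ • (v - w, -(v - w)))
          + sin θ • (cos φ • ((‖v - w‖ / 2) • (h, -h)) + sin φ • ((‖v - w‖ / 2) • (i, -i))))
        - ψ (((2 : ℝ)⁻¹ • (v + w), (2 : ℝ)⁻¹ • (v + w)) + (2 : ℝ)⁻¹ • (v - w, -(v - w)))) := by
  have hk := unitK_smul_norm v w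
  have hσ : (‖v - w‖ / 2) • sigmaDir (unitK v w) h i θ φ =
      cos θ • (2 : ℝ)⁻¹ • (v - w) + sin θ • (cos φ • (‖v - w‖ / 2) • h
        + sin φ • (‖v - w‖ / 2) • i) := by
    have hk' : (2 : ℝ)⁻¹ • (v - w) = (‖v - w‖ / 2) • unitK v w := by
      conv_lhs => rw [← hk]
      module
    rw [sigmaDir, hk']
    module
  have e1 : (((2 : ℝ)⁻¹ • (v + w), (2 : ℝ)⁻¹ • (v + w)) + (2 : ℝ)⁻¹ • (v - w, -(v - w)) : E3 × E3)
      = (v, w) := by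
    ext1 <;> simp only [Prod.fst_add, Prod.snd_add, Prod.smul_fst, Prod.smul_snd] <;> module
  have e2 : (((2 : ℝ)⁻¹ • (v + w), (2 : ℝ)⁻¹ • (v + w))
          + cos θ • ((2 : ℝ)⁻¹ • (v - w, -(v - w)))
          + sin θ • (cos φ • ((‖v - w‖ / 2) • (h, -h)) + sin φ • ((‖v - w‖ / 2) • (i, -i)))
          : E3 × E3)
      = (vPost v w (sigmaDir (unitK v w) h i θ φ), vPostStar v w (sigmaDir (unitK v w) h i θ φ)) := by
    rw [vPost, vPostStar, hσ]
    ext1 <;> simp only [Prod.fst_add, Prod.snd_add, Prod.smul_fst, Prod.smul_snd] <;> module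
  rw [e1, e2, barGrad2, hψsymm (vPostStar _ _ _), hψsymm w v]
  ring

lemma norm_sigmaDir {k h i : E3} (hk : ‖k‖ = 1) (hh : ‖h‖ = 1) (hi : ‖i‖ = 1)
    (hkh : ⟪k, h⟫ = 0) (hki : ⟪k, i⟫ = 0) (hhi : ⟪h, i⟫ = 0) (θ φ : ℝ) :
    ‖sigmaDir k h i θ φ‖ = 1 := by
  have : ‖sigmaDir k h i θ φ‖ ^ 2 = 1 := by
    have hkk : ⟪k, k⟫ = 1 := by rw [real_inner_self_eq_norm_sq, hk, one_pow]
    have hhh : ⟪h, h⟫ = 1 := by rw [real_inner_self_eq_norm_sq, hh, one_pow]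
    have hii : ⟪i, i⟫ = 1 := by rw [real_inner_self_eq_norm_sq, hi, one_pow]
    have hhk : ⟪h, k⟫ = 0 := by rw [real_inner_comm, hkh]
    have hik : ⟪i, k⟫ = 0 := by rw [real_inner_comm, hki]
    have hih : ⟪i, h⟫ = 0 := by rw [real_inner_comm, hhi]
    rw [← real_inner_self_eq_norm_sq, sigmaDir]
    simp only [inner_add_left, inner_add_right, real_inner_smul_left, real_inner_smul_right,
      hkk, hhh, hii, hkh, hki, hhi, hhk, hik, hih]
    linear_combination (sin_sq_add_cos_sq θ) + sin θ ^ 2 * (sin_sq_add_cos_sq φ)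
  nlinarith [norm_nonneg (sigmaDir k h i θ φ)]

lemma vPost_sub_vPostStar (v w σ : E3) : vPost v w σ - vPostStar v w σ = ‖v - w‖ • σ := by
  rw [vPost, vPostStar]
  module

lemma vPost_add_vPostStar (v w σ : E3) : vPost v w σ + vPostStar v w σ = v + w := by
  rw [vPost, vPostStar]
  module

lemma barGrad2_eq_zero_of_norm_sub_le {ψ : E3 × E3 → ℝ} {δ : ℝ}
    (hδ : ∀ v w : E3, ‖v - w‖ ≤ δ → ψ (v, w) = 0) {v w σ : E3} (hσ : v ≠ w → ‖σ‖ = 1)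
    (hvw : ‖v - w‖ ≤ δ) : barGrad2 ψ v w σ = 0 := by
  have h1 : ‖vPost v w σ - vPostStar v w σ‖ = ‖v - w‖ := by
    rw [vPost_sub_vPostStar, norm_smul, norm_norm]
    rcases eq_or_ne v w with rfl | hne
    · simp
    · rw [hσ hne, mul_one]
  rw [barGrad2, hδ _ _ (h1.trans_le hvw), hδ _ _ ((norm_sub_rev _ _).trans_le (h1.trans_le hvw)),
    hδ _ _ hvw, hδ _ _ ((norm_sub_rev _ _).trans_le hvw)]
  norm_num

lemma barGrad2_eq_zero_of_lt {ψ : E3 × E3 → ℝ} {R : ℝ}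
    (hR : ∀ q, R < ‖q‖ → ψ q = 0) (hR0 : 0 ≤ R) {v w σ : E3} (hσ : v ≠ w → ‖σ‖ = 1)
    (hvw : 2 * R < ‖(v, w)‖) : barGrad2 ψ v w σ = 0 := by
  have h1 : ‖vPost v w σ - vPostStar v w σ‖ = ‖v - w‖ := by
    rw [vPost_sub_vPostStar, norm_smul, norm_norm]
    rcases eq_or_ne v w with rfl | hne
    · simp
    · rw [hσ hne, mul_one]
  have h2 : ‖vPost v w σ‖ + ‖vPostStar v w σ‖ ≥ ‖(v, w)‖ := by
    have ha := norm_add_le (vPost v w σ) (vPostStar v w σ)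
    have hs := norm_sub_le (vPost v w σ) (vPostStar v w σ)
    rw [vPost_add_vPostStar] at ha
    rw [h1] at hs
    have hv : ‖(2 : ℝ) • v‖ ≤ ‖v + w‖ + ‖v - w‖ := by
      rw [show (2 : ℝ) • v = (v + w) + (v - w) by module]
      exact norm_add_le _ _
    have hw : ‖(2 : ℝ) • w‖ ≤ ‖v + w‖ + ‖v - w‖ := by
      rw [show (2 : ℝ) • w = (v + w) - (v - w) by module]
      exact norm_sub_le _ _
    rw [norm_smul, norm_ofNat] at hv hw
    exact max_le (by linarith) (by linarith)
  have h3 : R < ‖(vPost v w σ, vPostStar v w σ)‖ := by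
    rw [Prod.norm_mk, lt_max_iff]
    by_contra! hc
    linarith
  have hswap : ∀ a b : E3, ‖(b, a)‖ = ‖(a, b)‖ := fun a b => by
    rw [Prod.norm_mk, Prod.norm_mk, max_comm]
  rw [barGrad2, hR _ h3, hR _ ((hswap _ _).symm ▸ h3), hR (v, w) (by linarith),
    hR (w, v) (by rw [hswap]; linarith)]
  norm_num

lemma divDiff_eq_sum {F : E3 × E3 → E3} {v w : E3} (hF : DifferentiableAt ℝ F (v, w))
    {ι : Type*} [Fintype ι] (b : OrthonormalBasis ι ℝ E3) :
    divDiff F v w = ∑ j, ⟪b j, fderiv ℝ F (v, w) (b j, -b j)⟫ := by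
  have h1 : fderiv ℝ (fun z => F (z, w)) v =
      (fderiv ℝ F (v, w)).comp (ContinuousLinearMap.inl ℝ E3 E3) :=
    (hF.hasFDerivAt.comp v (hasFDerivAt_prodMk_left v w)).fderiv
  have h2 : fderiv ℝ (fun z => F (v, z)) w =
      (fderiv ℝ F (v, w)).comp (ContinuousLinearMap.inr ℝ E3 E3) :=
    (hF.hasFDerivAt.comp w (hasFDerivAt_prodMk_right v w)).fderiv
  rw [divDiff, h1, h2, LinearMap.trace_eq_sum_inner _ b, LinearMap.trace_eq_sum_inner _ b,
    ← Finset.sum_sub_distrib]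
  refine Finset.sum_congr rfl fun j _ => ?_
  rw [← inner_sub_right]
  congr 1
  change fderiv ℝ F (v, w) (b j, 0) - fderiv ℝ F (v, w) (0, b j) = _
  rw [← map_sub]
  simp

lemma inner_gradDiff {ψ : E3 × E3 → ℝ} (hψ : Differentiable ℝ ψ) (r : E3 × E3) (u : E3) :
    ⟪gradDiff ψ r, u⟫ = fderiv ℝ ψ r (u, -u) := by
  have h1 : fderiv ℝ (fun z => ψ (z, r.2)) r.1 =
      (fderiv ℝ ψ r).comp (ContinuousLinearMap.inl ℝ E3 E3) :=
    ((hψ r).hasFDerivAt.comp r.1 (hasFDerivAt_prodMk_left r.1 r.2)).fderiv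
  have h2 : fderiv ℝ (fun z => ψ (r.1, z)) r.2 =
      (fderiv ℝ ψ r).comp (ContinuousLinearMap.inr ℝ E3 E3) :=
    ((hψ r).hasFDerivAt.comp r.2 (hasFDerivAt_prodMk_right r.1 r.2)).fderiv
  rw [gradDiff, inner_sub_left, ← InnerProductSpace.toDual_apply_apply (𝕜 := ℝ),
    ← InnerProductSpace.toDual_apply_apply (𝕜 := ℝ), toDual_gradient, toDual_gradient, h1, h2]
  change fderiv ℝ ψ r (u, 0) - fderiv ℝ ψ r (0, u) = _
  rw [← map_sub]
  simp

lemma differentiable_gradDiff {ψ : E3 × E3 → ℝ} (hψ : ContDiff ℝ 2 ψ) :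
    Differentiable ℝ (gradDiff ψ) := by
  have h1 : ContDiff ℝ 1 (fderiv ℝ ψ) := hψ.fderiv_right (by norm_num)
  have hd : Differentiable ℝ (fderiv ℝ ψ) := h1.differentiable (by norm_num)
  rw [differentiable_euclidean]
  intro j
  have : (fun r => gradDiff ψ r j) = fun r => fderiv ℝ ψ r
      (EuclideanSpace.single j 1, -EuclideanSpace.single j 1) := by
    ext r
    rw [← inner_gradDiff (hψ.differentiable (by norm_num)), EuclideanSpace.inner_single_right]
    simp
  rw [this]
  fun_prop

lemma inner_self_projPerp (z u : E3) : ⟪z, projPerp z u⟫ = 0 := by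
  rcases eq_or_ne z 0 with rfl | hz
  · simp
  · rw [projPerp, inner_sub_right, real_inner_smul_right, real_inner_self_eq_norm_sq]
    have : ‖z‖ ≠ 0 := norm_ne_zero_iff.2 hz
    field_simp
    ring

lemma differentiableAt_projField {ψ : E3 × E3 → ℝ} (hψ : ContDiff ℝ 2 ψ) (s : ℝ) {v w : E3}
    (hvw : v ≠ w) : DifferentiableAt ℝ (fun r : E3 × E3 =>
      (‖r.1 - r.2‖ ^ s) • projPerp (r.1 - r.2) (gradDiff ψ r)) (v, w) := by
  have hz : v - w ≠ 0 := sub_ne_zero.2 hvw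
  have hz' : ‖v - w‖ ≠ 0 := norm_ne_zero_iff.2 hz
  have hg := differentiable_gradDiff hψ (v, w)
  have hd : DifferentiableAt ℝ (fun r : E3 × E3 => r.1 - r.2) (v, w) := by fun_prop
  have hn : DifferentiableAt ℝ (fun r : E3 × E3 => ‖r.1 - r.2‖) (v, w) := hd.norm ℝ hz
  have hn2 : DifferentiableAt ℝ (fun r : E3 × E3 => (‖r.1 - r.2‖ ^ 2)⁻¹) (v, w) :=
    (hn.pow 2).inv (pow_ne_zero 2 hz')
  exact (hn.rpow_const (Or.inl hz')).smul (hg.sub ((hn2.mul (hd.inner ℝ hg)).smul hd))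

lemma inner_fderiv_projField_of_inner_eq_zero {ψ : E3 × E3 → ℝ} (hψ : ContDiff ℝ 2 ψ) (γ : ℝ)
    {v w : E3} (hvw : v ≠ w) {b : E3} (hb : ‖b‖ = 1) (hzb : ⟪v - w, b⟫ = 0) :
    ⟪b, fderiv ℝ (fun r : E3 × E3 =>
      (‖r.1 - r.2‖ ^ (2 + γ)) • projPerp (r.1 - r.2) (gradDiff ψ r)) (v, w) (b, -b)⟫ =
    ‖v - w‖ ^ γ * (‖v - w‖ ^ 2 * fderiv ℝ (fderiv ℝ ψ) (v, w) (b, -b) (b, -b)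
      - 2 * fderiv ℝ ψ (v, w) (v - w, -(v - w))) := by
  have hz' : 0 < ‖v - w‖ := norm_pos_iff.2 (sub_ne_zero.2 hvw)
  have hψ1 : Differentiable ℝ ψ := hψ.differentiable (by norm_num)
  have h1 : ContDiff ℝ 1 (fderiv ℝ ψ) := hψ.fderiv_right (by norm_num)
  have hd1 : Differentiable ℝ (fderiv ℝ ψ) := h1.differentiable (by norm_num)
  have hF := differentiableAt_projField hψ (2 + γ) hvw
  set F : E3 × E3 → E3 := fun r =>
    (‖r.1 - r.2‖ ^ (2 + γ)) • projPerp (r.1 - r.2) (gradDiff ψ r) with hFdef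
  have hpath : HasDerivAt (fun t : ℝ => ((v, w) : E3 × E3) + t • (b, -b)) (b, -b) 0 := by
    simpa using ((hasDerivAt_id (0 : ℝ)).smul_const ((b, -b) : E3 × E3)).const_add (v, w)
  have hFd : HasDerivAt (fun t : ℝ => ⟪b, F ((v, w) + t • (b, -b))⟫)
      ⟪b, fderiv ℝ F (v, w) (b, -b)⟫ 0 := by
    have hF' : HasFDerivAt F (fderiv ℝ F (v, w)) ((v, w) + (0 : ℝ) • (b, -b)) := by
      simpa using hF.hasFDerivAt
    simpa using (hasDerivAt_const (0 : ℝ) b).inner ℝ (hF'.comp_hasDerivAt 0 hpath)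
  have hzt : ∀ t : ℝ, (((v, w) : E3 × E3) + t • (b, -b)).1 - (((v, w) : E3 × E3) + t • (b, -b)).2
      = (v - w) + (2 * t) • b := fun t => by
    simp only [Prod.fst_add, Prod.snd_add, Prod.smul_fst, Prod.smul_snd]
    module
  have hnorm : ∀ t : ℝ, ‖(v - w) + (2 * t) • b‖ ^ 2 = ‖v - w‖ ^ 2 + 4 * t ^ 2 := fun t => by
    rw [norm_add_sq_real, real_inner_smul_right, hzb, norm_smul, hb, norm_eq_abs, mul_one, sq_abs]
    ring
  have hbz : ∀ t : ℝ, ⟪b, (v - w) + (2 * t) • b⟫ = 2 * t := fun t => by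
    rw [inner_add_right, real_inner_comm, hzb, real_inner_smul_right, real_inner_self_eq_norm_sq,
      hb]
    ring
  have hFt : ∀ t : ℝ, ⟪b, F ((v, w) + t • (b, -b))⟫ =
      √(‖v - w‖ ^ 2 + 4 * t ^ 2) ^ (2 + γ) * (fderiv ℝ ψ ((v, w) + t • (b, -b)) (b, -b)
        - (‖v - w‖ ^ 2 + 4 * t ^ 2)⁻¹ * (fderiv ℝ ψ ((v, w) + t • (b, -b))
          ((v - w) + (2 * t) • b, -((v - w) + (2 * t) • b))) * (2 * t)) := fun t => by
    simp only [hFdef, hzt, projPerp]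
    rw [real_inner_smul_right, inner_sub_right, real_inner_smul_right, hbz, hnorm,
      real_inner_comm, inner_gradDiff hψ1, real_inner_comm, inner_gradDiff hψ1, ← hnorm,
      Real.sqrt_sq (norm_nonneg _)]
  have hs : HasDerivAt (fun t : ℝ => ‖v - w‖ ^ 2 + 4 * t ^ 2) 0 0 := by
    simpa using ((hasDerivAt_pow 2 (0 : ℝ)).const_mul 4).const_add (‖v - w‖ ^ 2)
  have hs0 : ‖v - w‖ ^ 2 + 4 * (0 : ℝ) ^ 2 ≠ 0 := by positivity
  have hN : HasDerivAt (fun t : ℝ => √(‖v - w‖ ^ 2 + 4 * t ^ 2) ^ (2 + γ)) 0 0 := by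
    have := (hs.sqrt hs0).rpow_const (p := 2 + γ) (Or.inl (by positivity))
    simpa using this
  have hψ2 : HasDerivAt (fun t : ℝ => fderiv ℝ ψ ((v, w) + t • (b, -b)))
      (fderiv ℝ (fderiv ℝ ψ) (v, w) (b, -b)) 0 := by
    have h2 : HasFDerivAt (fderiv ℝ ψ) (fderiv ℝ (fderiv ℝ ψ) (v, w))
        ((v, w) + (0 : ℝ) • (b, -b)) := by
      simpa using (hd1 (v, w)).hasFDerivAt
    exact h2.comp_hasDerivAt 0 hpath
  have hQ : HasDerivAt (fun t : ℝ => fderiv ℝ ψ ((v, w) + t • (b, -b)) (b, -b))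
      (fderiv ℝ (fderiv ℝ ψ) (v, w) (b, -b) (b, -b)) 0 := by
    simpa using hψ2.clm_apply (hasDerivAt_const 0 ((b, -b) : E3 × E3))
  have hU : DifferentiableAt ℝ (fun t : ℝ => (‖v - w‖ ^ 2 + 4 * t ^ 2)⁻¹ *
      (fderiv ℝ ψ ((v, w) + t • (b, -b)) ((v - w) + (2 * t) • b, -((v - w) + (2 * t) • b)))) 0 := by
    refine (hs.differentiableAt.inv hs0).mul (hψ2.differentiableAt.clm_apply ?_)
    fun_prop
  have ht : HasDerivAt (fun t : ℝ => 2 * t) 2 0 := by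
    simpa using (hasDerivAt_id (0 : ℝ)).const_mul 2
  have htot := hN.mul (hQ.sub (hU.hasDerivAt.mul ht))
  rw [funext hFt] at hFd
  rw [hFd.unique htot]
  have hp : √(‖v - w‖ ^ 2 + 4 * (0 : ℝ) ^ 2) ^ (2 + γ) = ‖v - w‖ ^ γ * ‖v - w‖ ^ 2 := by
    rw [show ‖v - w‖ ^ 2 + 4 * (0 : ℝ) ^ 2 = ‖v - w‖ ^ 2 by ring, Real.sqrt_sq hz'.le,
      add_comm, Real.rpow_add hz', Real.rpow_two]
  simp only [hp]
  simp
  field_simp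

lemma inner_unitK_fderiv_projField {ψ : E3 × E3 → ℝ} (hψ : ContDiff ℝ 2 ψ) (s : ℝ)
    {v w : E3} (hvw : v ≠ w) :
    ⟪unitK v w, fderiv ℝ (fun r : E3 × E3 =>
      (‖r.1 - r.2‖ ^ s) • projPerp (r.1 - r.2) (gradDiff ψ r)) (v, w)
      (unitK v w, -unitK v w)⟫ = 0 := by
  have hz' : 0 < ‖v - w‖ := norm_pos_iff.2 (sub_ne_zero.2 hvw)
  have hF := differentiableAt_projField hψ s hvw
  have hk := unitK_smul_norm v w
  set k := unitK v w
  set F : E3 × E3 → E3 := fun r =>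
    (‖r.1 - r.2‖ ^ s) • projPerp (r.1 - r.2) (gradDiff ψ r) with hFdef
  have hpath : HasDerivAt (fun t : ℝ => ((v, w) : E3 × E3) + t • (k, -k)) (k, -k) 0 := by
    simpa using ((hasDerivAt_id (0 : ℝ)).smul_const ((k, -k) : E3 × E3)).const_add (v, w)
  have hFd : HasDerivAt (fun t : ℝ => ⟪k, F ((v, w) + t • (k, -k))⟫)
      ⟪k, fderiv ℝ F (v, w) (k, -k)⟫ 0 := by
    have hF' : HasFDerivAt F (fderiv ℝ F (v, w)) ((v, w) + (0 : ℝ) • (k, -k)) := by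
      simpa using hF.hasFDerivAt
    simpa using (hasDerivAt_const (0 : ℝ) k).inner ℝ (hF'.comp_hasDerivAt 0 hpath)
  refine hFd.unique ((hasDerivAt_const (0 : ℝ) (0 : ℝ)).congr_of_eventuallyEq ?_)
  have hev : ∀ᶠ t : ℝ in 𝓝 0, 0 < ‖v - w‖ + 2 * t := by
    have hc : Continuous fun t : ℝ => ‖v - w‖ + 2 * t := by fun_prop
    exact (hc.tendsto 0).eventually (lt_mem_nhds (by simpa using hz'))
  filter_upwards [hev] with t ht
  have hzt : (((v, w) : E3 × E3) + t • (k, -k)).1 - (((v, w) : E3 × E3) + t • (k, -k)).2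
      = (‖v - w‖ + 2 * t) • k := by
    rw [add_smul, hk]
    simp only [Prod.fst_add, Prod.snd_add, Prod.smul_fst, Prod.smul_snd]
    module
  have h0 := inner_self_projPerp ((‖v - w‖ + 2 * t) • k) (gradDiff ψ ((v, w) + t • (k, -k)))
  rw [real_inner_smul_left] at h0
  simp only [hFdef]
  rw [hzt, real_inner_smul_right, (mul_eq_zero.1 h0).resolve_left ht.ne', mul_zero]

lemma divDiff_projField {ψ : E3 × E3 → ℝ} (hψ : ContDiff ℝ 2 ψ) (γ : ℝ) {v w h i : E3}
    (hvw : v ≠ w) (hh : ‖h‖ = 1) (hi : ‖i‖ = 1) (hkh : ⟪unitK v w, h⟫ = 0)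
    (hki : ⟪unitK v w, i⟫ = 0) (hhi : ⟪h, i⟫ = 0) :
    divDiff (fun r : E3 × E3 => (‖r.1 - r.2‖ ^ (2 + γ)) • projPerp (r.1 - r.2) (gradDiff ψ r)) v w =
      ‖v - w‖ ^ γ * (‖v - w‖ ^ 2 * (fderiv ℝ (fderiv ℝ ψ) (v, w) (h, -h) (h, -h)
        + fderiv ℝ (fderiv ℝ ψ) (v, w) (i, -i) (i, -i))
        - 4 * fderiv ℝ ψ (v, w) (v - w, -(v - w))) := by
  have hk := norm_unitK hvw
  have hon : Orthonormal ℝ ![unitK v w, h, i] := by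
    refine ⟨fun j => by fin_cases j <;> simp [hk, hh, hi], fun j l hjl => ?_⟩
    fin_cases j <;> fin_cases l <;>
      simp_all [real_inner_comm (unitK v w) h, real_inner_comm (unitK v w) i, real_inner_comm h i]
  have hspan : ⊤ ≤ Submodule.span ℝ (Set.range ![unitK v w, h, i]) :=
    (hon.linearIndependent.span_eq_top_of_card_eq_finrank (by simp)).ge
  have hz : ∀ u, ⟪unitK v w, u⟫ = 0 → ⟪v - w, u⟫ = 0 := fun u hu => by
    rw [← unitK_smul_norm v w, real_inner_smul_left, hu, mul_zero]
  rw [divDiff_eq_sum (differentiableAt_projField hψ (2 + γ) hvw) (OrthonormalBasis.mk hon hspan),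
    Fin.sum_univ_three]
  simp only [OrthonormalBasis.coe_mk, Matrix.cons_val_zero, Matrix.cons_val_one, Matrix.cons_val]
  rw [inner_unitK_fderiv_projField hψ (2 + γ) hvw,
    inner_fderiv_projField_of_inner_eq_zero hψ γ hvw hh (hz h hkh),
    inner_fderiv_projField_of_inner_eq_zero hψ γ hvw hi (hz i hki)]
  ring

/-- The projected gradient field vanishes near the diagonal, and so does its divergence. -/
lemma divDiff_projField_self {ψ : E3 × E3 → ℝ} (hψ : Differentiable ℝ ψ) {δ : ℝ} (hδ0 : 0 < δ)
    (hδ : ∀ v w : E3, ‖v - w‖ ≤ δ → ψ (v, w) = 0) (s : ℝ) (v : E3) :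
    divDiff (fun r : E3 × E3 => (‖r.1 - r.2‖ ^ s) • projPerp (r.1 - r.2) (gradDiff ψ r)) v v = 0 := by
  have hopen : IsOpen {r : E3 × E3 | ‖r.1 - r.2‖ < δ} := isOpen_lt (by fun_prop) continuous_const
  have hgrad : ∀ r : E3 × E3, ‖r.1 - r.2‖ < δ → gradDiff ψ r = 0 := fun r hr => by
    refine ext_inner_right ℝ fun u => ?_
    have : ψ =ᶠ[𝓝 r] fun _ => 0 := by
      filter_upwards [hopen.mem_nhds hr] with q hq using hδ q.1 q.2 (le_of_lt hq)
    rw [inner_gradDiff hψ, this.fderiv_eq]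
    simp
  have hF : (fun r : E3 × E3 => (‖r.1 - r.2‖ ^ s) • projPerp (r.1 - r.2) (gradDiff ψ r))
      =ᶠ[𝓝 (v, v)] fun _ => 0 := by
    filter_upwards [hopen.mem_nhds (show ‖v - v‖ < δ by simpa using hδ0)] with q hq
    rw [hgrad q hq]
    simp [projPerp]
  rw [divDiff_eq_sum (hF.differentiableAt_iff.2 (differentiableAt_const 0))
    (EuclideanSpace.basisFun (Fin 3) ℝ), hF.fderiv_eq]
  simp

end Geometry

section Grazing

/-- The rescaled collision kernel acting on the discrete gradient of `ψ`. -/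
def grazingOp (γ : ℝ) (β : ℝ → ℝ) (ψ : E3 × E3 → ℝ) (h i : E3 × E3 → E3) (ε : ℝ) (q : E3 × E3) : ℝ :=
  ‖q.1 - q.2‖ ^ γ *
    ∫ θ in Set.Ioc (0:ℝ) (ε / 2), (π ^ 3 / ε ^ 3) * β (π * θ / ε) *
      ∫ φ in Set.Ioc (0:ℝ) (2 * π),
        barGrad2 ψ q.1 q.2 (sigmaDir (unitK q.1 q.2) (h q) (i q) θ φ)

variable {γ : ℝ} {β : ℝ → ℝ} {ψ : E3 × E3 → ℝ} {h i : E3 × E3 → E3}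

lemma measurable_circle_barGrad2 (hψ : Measurable ψ) (hhm : Measurable h) (him : Measurable i) :
    Measurable fun p : (E3 × E3) × ℝ => ∫ φ in Set.Ioc (0:ℝ) (2 * π),
      barGrad2 ψ p.1.1 p.1.2 (sigmaDir (unitK p.1.1 p.1.2) (h p.1) (i p.1) p.2 φ) := by
  have : Measurable fun p : ((E3 × E3) × ℝ) × ℝ => barGrad2 ψ p.1.1.1 p.1.1.2
      (sigmaDir (unitK p.1.1.1 p.1.1.2) (h p.1.1) (i p.1.1) p.1.2 p.2) := by
    unfold barGrad2 vPost vPostStar sigmaDir unitK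
    fun_prop
  exact this.stronglyMeasurable.integral_prod_right.measurable

lemma measurable_grazingOp (hβm : Measurable β) (hψ : Measurable ψ) (hhm : Measurable h)
    (him : Measurable i) (ε : ℝ) : Measurable (grazingOp γ β ψ h i ε) := by
  have hc := measurable_circle_barGrad2 hψ hhm him
  have h1 : Measurable fun p : (E3 × E3) × ℝ => (π ^ 3 / ε ^ 3) * β (π * p.2 / ε) *
      ∫ φ in Set.Ioc (0:ℝ) (2 * π),
        barGrad2 ψ p.1.1 p.1.2 (sigmaDir (unitK p.1.1 p.1.2) (h p.1) (i p.1) p.2 φ) := by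
    fun_prop
  have h2 := (h1.stronglyMeasurable.integral_prod_right'
    (ν := volume.restrict (Set.Ioc (0:ℝ) (ε / 2)))).measurable
  have h3 : Measurable fun q : E3 × E3 => ‖q.1 - q.2‖ ^ γ := by fun_prop
  exact h3.mul h2

lemma circle_barGrad2_eq (hψsymm : ∀ v w : E3, ψ (v, w) = ψ (w, v)) (v w h i : E3) (θ : ℝ) :
    ∫ φ in Set.Ioc (0:ℝ) (2 * π), barGrad2 ψ v w (sigmaDir (unitK v w) h i θ φ) =
      2 * circleIncr ψ ((2 : ℝ)⁻¹ • (v + w), (2 : ℝ)⁻¹ • (v + w)) ((2 : ℝ)⁻¹ • (v - w, -(v - w)))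
        ((‖v - w‖ / 2) • (h, -h)) ((‖v - w‖ / 2) • (i, -i)) θ := by
  simp only [barGrad2_sigmaDir hψsymm]
  rw [integral_const_mul, circleIncr]

lemma grazingOp_eq_zero {q : E3 × E3}
    (hq : ∀ θ φ, barGrad2 ψ q.1 q.2 (sigmaDir (unitK q.1 q.2) (h q) (i q) θ φ) = 0) (ε : ℝ) :
    grazingOp γ β ψ h i ε q = 0 := by
  simp [grazingOp, hq]

lemma tendsto_rescaled_circleIncr {V : Type*} [NormedAddCommGroup V] [NormedSpace ℝ V] {ψ : V → ℝ}
    (hψ : ContDiff ℝ 2 ψ) {M : ℝ} (h1 : ∀ x, ‖fderiv ℝ ψ x‖ ≤ M)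
    (h2 : ∀ x, ‖fderiv ℝ (fderiv ℝ ψ) x‖ ≤ M) (hβm : Measurable β)
    (hβi : IntegrableOn (fun θ => θ ^ 2 * β θ) (Set.Ioc 0 (π / 2))) {m a H I : V}
    (hgm : Measurable fun θ => 2 * circleIncr ψ m a H I θ) :
    Tendsto (fun ε : ℝ => ∫ θ in Set.Ioc (0:ℝ) (ε / 2), (π ^ 3 / ε ^ 3) * β (π * θ / ε) *
        (2 * circleIncr ψ m a H I θ)) (𝓝[>] 0)
      (𝓝 ((∫ θ in Set.Ioc (0:ℝ) (π / 2), θ ^ 2 * β θ) *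
        (2 * (π / 2 * (fderiv ℝ (fderiv ℝ ψ) (m + a) H H + fderiv ℝ (fderiv ℝ ψ) (m + a) I I
          - 2 * fderiv ℝ ψ (m + a) a))))) := by
  refine tendsto_rescaled_kernel hβm hβi hgm (K := 2 * (π * (M * (‖a‖ + (‖H‖ + ‖I‖)) ^ 2 +
    M * (‖a‖ + (‖H‖ + ‖I‖))))) (fun t ht => ?_) ?_
  · rw [abs_mul, abs_two, mul_assoc]
    exact mul_le_mul_of_nonneg_left (abs_circleIncr_le hψ h1 h2 le_rfl ht) two_pos.le
  · simp only [mul_div_assoc]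
    exact (tendsto_circleIncr hψ h1 h2 m a H I).const_mul 2

lemma tendsto_grazingOp (hψ : ContDiff ℝ 2 ψ) {M : ℝ} (h1 : ∀ x, ‖fderiv ℝ ψ x‖ ≤ M)
    (h2 : ∀ x, ‖fderiv ℝ (fderiv ℝ ψ) x‖ ≤ M) (hβm : Measurable β)
    (hβi : IntegrableOn (fun θ => θ ^ 2 * β θ) (Set.Ioc 0 (π / 2)))
    (hβnorm : ∫ θ in Set.Ioc (0:ℝ) (π / 2), θ ^ 2 * β θ = 8 / π)
    (hψsymm : ∀ v w : E3, ψ (v, w) = ψ (w, v)) (hhm : Measurable h) (him : Measurable i)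
    {v w : E3} (hvw : v ≠ w) (hh : ‖h (v, w)‖ = 1) (hi : ‖i (v, w)‖ = 1)
    (hkh : ⟪unitK v w, h (v, w)⟫ = 0) (hki : ⟪unitK v w, i (v, w)⟫ = 0)
    (hhi : ⟪h (v, w), i (v, w)⟫ = 0) :
    Tendsto (fun ε => grazingOp γ β ψ h i ε (v, w)) (𝓝[>] 0)
      (𝓝 (2 * divDiff (fun r : E3 × E3 =>
        (‖r.1 - r.2‖ ^ (2 + γ)) • projPerp (r.1 - r.2) (gradDiff ψ r)) v w)) := by
  have hgm := (measurable_circle_barGrad2 hψ.continuous.measurable hhm him).comp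
    (measurable_prodMk_left (x := (v, w)))
  simp only [Function.comp_def, circle_barGrad2_eq hψsymm] at hgm
  have hcenter : (((2 : ℝ)⁻¹ • (v + w), (2 : ℝ)⁻¹ • (v + w)) + (2 : ℝ)⁻¹ • (v - w, -(v - w))
      : E3 × E3) = (v, w) := by
    ext1 <;> simp only [Prod.fst_add, Prod.snd_add, Prod.smul_fst, Prod.smul_snd] <;> module
  have key := (tendsto_rescaled_circleIncr hψ h1 h2 hβm hβi hgm).const_mul (‖v - w‖ ^ γ)
  rw [hcenter, hβnorm] at key
  simp only [grazingOp, circle_barGrad2_eq hψsymm]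
  convert key using 2
  rw [divDiff_projField hψ γ hvw hh hi hkh hki hhi]
  simp only [map_smul, smul_apply, smul_eq_mul]
  have := pi_pos
  field_simp
  ring

lemma abs_grazingOp_le (hψ : ContDiff ℝ 2 ψ) {M : ℝ} (h1 : ∀ x, ‖fderiv ℝ ψ x‖ ≤ M)
    (h2 : ∀ x, ‖fderiv ℝ (fderiv ℝ ψ) x‖ ≤ M) (hβ0 : ∀ θ, 0 ≤ β θ)
    (hβi : IntegrableOn (fun θ => θ ^ 2 * β θ) (Set.Ioc 0 (π / 2)))
    (hψsymm : ∀ v w : E3, ψ (v, w) = ψ (w, v)) (hγ : γ ≤ 0) {δ R : ℝ} (hδ0 : 0 < δ)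
    {v w : E3} (hδ : δ < ‖v - w‖) (hR : ‖(v, w)‖ ≤ R)
    (hh : ‖h (v, w)‖ = 1) (hi : ‖i (v, w)‖ = 1) {ε : ℝ} (hε : 0 < ε) :
    |grazingOp γ β ψ h i ε (v, w)| ≤ δ ^ γ * ((∫ θ in Set.Ioc (0:ℝ) (π / 2), θ ^ 2 * β θ) *
      (2 * (π * (M * (3 * R) ^ 2 + M * (3 * R))))) := by
  have hpair : ∀ u : E3, ‖(u, -u)‖ = ‖u‖ := fun u => by rw [Prod.norm_mk, norm_neg, max_self]
  have hz : ‖v - w‖ ≤ 2 * R := by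
    have := norm_sub_le v w
    have h3 : ‖v‖ ≤ R := (norm_fst_le (v, w)).trans hR
    have h4 : ‖w‖ ≤ R := (norm_snd_le (v, w)).trans hR
    linarith
  have hK : ‖(2 : ℝ)⁻¹ • (v - w, -(v - w))‖ + (‖(‖v - w‖ / 2) • (h (v, w), -h (v, w))‖
      + ‖(‖v - w‖ / 2) • (i (v, w), -i (v, w))‖) ≤ 3 * R := by
    rw [norm_smul, norm_smul, norm_smul, hpair, hpair, hpair, hh, hi, norm_inv, norm_ofNat,
      norm_div, norm_norm, norm_ofNat]
    linarith
  rw [grazingOp, abs_mul, abs_of_nonneg (rpow_nonneg (norm_nonneg _) γ)]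
  refine mul_le_mul (rpow_le_rpow_of_nonpos hδ0 hδ.le hγ) ?_ (abs_nonneg _) (by positivity)
  refine abs_rescaled_kernel_le hβ0 hβi (fun t ht => ?_) hε
  rw [circle_barGrad2_eq hψsymm, abs_mul, abs_two, mul_assoc]
  exact mul_le_mul_of_nonneg_left (abs_circleIncr_le hψ h1 h2 hK ht) two_pos.le

end Grazing

section SqrtIntegrable

variable {X : Type*} [MeasurableSpace X] {μ : Measure X}

lemma MeasureTheory.Integrable.real_sqrt [IsFiniteMeasure μ] {f : X → ℝ} (hf : Integrable f μ) :
    Integrable (fun x => √(f x)) μ := by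
  refine ((integrable_const (1 : ℝ)).add hf.abs).mono'
    (continuous_sqrt.comp_aestronglyMeasurable hf.aestronglyMeasurable)
    (Eventually.of_forall fun x => ?_)
  rw [norm_of_nonneg (sqrt_nonneg _)]
  refine sqrt_le_iff.2 ⟨by simp only [Pi.add_apply]; positivity, ?_⟩
  simp only [Pi.add_apply]
  nlinarith [abs_nonneg (f x), le_abs_self (f x)]

lemma integrable_sq_sqrt_sub_sqrt {f g : X → ℝ} (hf : Integrable f μ) (hg : Integrable g μ) :
    Integrable (fun x => (√(f x) - √(g x)) ^ 2) μ := by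
  refine (hf.abs.add hg.abs).mono'
    (((continuous_sqrt.comp_aestronglyMeasurable hf.aestronglyMeasurable).sub
      (continuous_sqrt.comp_aestronglyMeasurable hg.aestronglyMeasurable)).pow 2)
    (Eventually.of_forall fun x => ?_)
  have hs : ∀ y : ℝ, √y ^ 2 ≤ |y| := fun y => by
    rcases le_total 0 y with hy | hy
    · rw [sq_sqrt hy, abs_of_nonneg hy]
    · simp [sqrt_eq_zero_of_nonpos hy]
  rw [norm_of_nonneg (sq_nonneg _)]
  simp only [Pi.add_apply]
  nlinarith [hs (f x), hs (g x), mul_nonneg (sqrt_nonneg (f x)) (sqrt_nonneg (g x))]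

end SqrtIntegrable

/-- Weak–strong convergence in the grazing collision limit: if `√(f^ε) → √f` in
`L²_loc(ℝ³)` as `ε ↓ 0`, then for every `ψ ∈ DS_c^∞`, the quantity
`∫∫ √(f^ε f^ε_∗)(|v−v∗|^γ ∫₀^{ε/2} β^ε ∫₀^{2π} ∇̄ψ dφ dθ) dv∗ dv` converges to
`2 ∫∫ √(f f∗)(div_v − div_{v∗})[|v−v∗|^{2+γ} Π[v−v∗]((∇_v − ∇_{v∗})ψ)] dv∗ dv`. -/
theorem grazing_limit_weak_strong_pairing
    (γ : ℝ) (hγ : γ ∈ Set.Ico (-4 : ℝ) 0)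
    (β : ℝ → ℝ) (hβm : Measurable β) (hβ0 : ∀ θ, 0 ≤ β θ)
    (hβnorm : ∫ θ in Set.Ioc (0:ℝ) (π / 2), θ ^ 2 * β θ = 8 / π)
    (fε : ℝ → E3 → ℝ) (f : E3 → ℝ)
    (hfεi : ∀ ε ∈ Set.Ioc (0:ℝ) 1, Integrable (fε ε))
    (hfε0 : ∀ ε ∈ Set.Ioc (0:ℝ) 1, ∀ v, 0 ≤ fε ε v)
    (hfi : Integrable f) (hf0 : ∀ v, 0 ≤ f v)
    (hL2loc : ∀ R > (0:ℝ), Filter.Tendsto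
      (fun ε : ℝ => ∫ v in Metric.ball (0 : E3) R,
        (Real.sqrt (fε ε v) - Real.sqrt (f v)) ^ 2)
      (𝓝[>] (0 : ℝ)) (𝓝 0))
    (ψ : E3 × E3 → ℝ) (hψ : ContDiff ℝ (⊤ : ℕ∞) ψ) (hψc : HasCompactSupport ψ)
    (hψsymm : ∀ v w : E3, ψ (v, w) = ψ (w, v))
    (hψdiag : ∃ δ > 0, ∀ v w : E3, ‖v - w‖ ≤ δ → ψ (v, w) = 0)
    (h i : E3 × E3 → E3) (hhm : Measurable h) (him : Measurable i)
    (honb : ∀ v w : E3, v ≠ w →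
      ‖h (v, w)‖ = 1 ∧ ‖i (v, w)‖ = 1 ∧
        ⟪unitK v w, h (v, w)⟫ = 0 ∧ ⟪unitK v w, i (v, w)⟫ = 0 ∧
        ⟪h (v, w), i (v, w)⟫ = 0) :
    Filter.Tendsto (fun ε : ℝ =>
        ∫ q : E3 × E3, Real.sqrt (fε ε q.1 * fε ε q.2) *
          (‖q.1 - q.2‖ ^ γ *
            ∫ θ in Set.Ioc (0:ℝ) (ε / 2), (π ^ 3 / ε ^ 3) * β (π * θ / ε) *
              ∫ φ in Set.Ioc (0:ℝ) (2 * π),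
                barGrad2 ψ q.1 q.2 (sigmaDir (unitK q.1 q.2) (h q) (i q) θ φ)))
      (𝓝[>] (0 : ℝ))
      (𝓝 (2 * ∫ q : E3 × E3, Real.sqrt (f q.1 * f q.2) *
        divDiff (fun r : E3 × E3 =>
            (‖r.1 - r.2‖ ^ (2 + γ)) • projPerp (r.1 - r.2) (gradDiff ψ r)) q.1 q.2)) := by
  obtain ⟨δ, hδ0, hδ⟩ := hψdiag
  obtain ⟨R, hR0, hRsupp⟩ := hψc.isCompact.isBounded.exists_pos_norm_le
  have hR : ∀ q, R < ‖q‖ → ψ q = 0 := fun q hq =>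
    image_eq_zero_of_notMem_tsupport fun hmem => (hRsupp q hmem).not_gt hq
  have hψ2 : ContDiff ℝ 2 ψ := contDiff_infty.1 hψ 2
  obtain ⟨M, h1, h2⟩ := exists_bound_fderiv hψ2 hψc
  have hβi : IntegrableOn (fun θ => θ ^ 2 * β θ) (Set.Ioc 0 (π / 2)) := by
    by_contra hni
    rw [integral_undef hni] at hβnorm
    have : 0 < 8 / π := by positivity
    linarith
  have hσ : ∀ v w θ φ, v ≠ w → ‖sigmaDir (unitK v w) (h (v, w)) (i (v, w)) θ φ‖ = 1 :=
    fun v w θ φ hvw => by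
      obtain ⟨a1, a2, a3, a4, a5⟩ := honb v w hvw
      exact norm_sigmaDir (norm_unitK hvw) a1 a2 a3 a4 a5 θ φ
  have hnear : ∀ (ε : ℝ) (v w : E3), ‖v - w‖ ≤ δ → grazingOp γ β ψ h i ε (v, w) = 0 := by
    intro ε v w hvw
    refine grazingOp_eq_zero (q := (v, w)) (fun θ φ => ?_) ε
    exact barGrad2_eq_zero_of_norm_sub_le hδ (hσ v w θ φ) hvw
  have hfar : ∀ (ε : ℝ) (q : E3 × E3), 2 * R < ‖q‖ → grazingOp γ β ψ h i ε q = 0 := by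
    intro ε q hq
    refine grazingOp_eq_zero (q := q) (fun θ φ => ?_) ε
    exact barGrad2_eq_zero_of_lt hR hR0.le (hσ q.1 q.2 θ φ) hq
  obtain ⟨C, hC⟩ : ∃ C, ∀ ε > 0, ∀ q, |grazingOp γ β ψ h i ε q| ≤ C := by
    refine ⟨max 0 (δ ^ γ * ((∫ θ in Set.Ioc (0:ℝ) (π / 2), θ ^ 2 * β θ) *
      (2 * (π * (M * (3 * (2 * R)) ^ 2 + M * (3 * (2 * R))))))), fun ε hε q => ?_⟩
    obtain ⟨v, w⟩ := q
    rcases le_or_gt ‖v - w‖ δ with hvw | hvw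
    · rw [hnear ε v w hvw, abs_zero]
      exact le_max_left _ _
    rcases lt_or_ge (2 * R) ‖(v, w)‖ with hq | hq
    · rw [hfar ε _ hq, abs_zero]
      exact le_max_left _ _
    have hne : v ≠ w := fun he => by
      rw [he, sub_self, norm_zero] at hvw
      exact hvw.not_ge hδ0.le
    obtain ⟨a1, a2, -⟩ := honb v w hne
    exact (abs_grazingOp_le hψ2 h1 h2 hβ0 hβi hψsymm hγ.2.le hδ0 hvw hq a1 a2 hε).trans
      (le_max_right _ _)
  set D : E3 × E3 → ℝ := fun q => divDiff (fun r : E3 × E3 =>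
    (‖r.1 - r.2‖ ^ (2 + γ)) • projPerp (r.1 - r.2) (gradDiff ψ r)) q.1 q.2
  have hlim : ∀ q, Tendsto (fun ε => grazingOp γ β ψ h i ε q) (𝓝[>] 0) (𝓝 (2 * D q)) := by
    rintro ⟨v, w⟩
    rcases eq_or_ne v w with rfl | hne
    · have hD0 : D (v, v) = 0 :=
        divDiff_projField_self (hψ2.differentiable (by norm_num)) hδ0 hδ (2 + γ) v
      simp only [hD0, hnear _ v v (by simpa using hδ0.le), mul_zero]
      exact tendsto_const_nhds
    · obtain ⟨a1, a2, a3, a4, a5⟩ := honb v w hne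
      exact tendsto_grazingOp hψ2 h1 h2 hβm hβi hβnorm hψsymm hhm him hne a1 a2 a3 a4 a5
  have hDfar : ∀ q : E3 × E3, 2 * R < ‖q‖ → 2 * D q = 0 := fun q hq => by
    refine tendsto_nhds_unique (hlim q) ?_
    simp only [hfar _ q hq]
    exact tendsto_const_nhds
  set S : Set E3 := Metric.ball 0 (2 * R + 1)
  have hSfar : ∀ q : E3 × E3, q ∉ S ×ˢ S → 2 * R < ‖q‖ := fun q hq => by
    by_contra! hle
    refine hq ⟨?_, ?_⟩ <;> rw [mem_ball_zero_iff]
    · exact (norm_fst_le q).trans_lt (by linarith)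
    · exact (norm_snd_le q).trans_lt (by linarith)
  have hfin : IsFiniteMeasure (volume.restrict S : Measure E3) :=
    isFiniteMeasure_restrict.2 measure_ball_lt_top.ne
  have hprod : (volume.restrict S : Measure E3).prod (volume.restrict S) =
      (volume : Measure (E3 × E3)).restrict (S ×ˢ S) := by
    rw [Measure.prod_restrict, Measure.volume_eq_prod]
  have hε1 : ∀ᶠ ε : ℝ in 𝓝[>] 0, ε ∈ Set.Ioc (0 : ℝ) 1 := Ioc_mem_nhdsGT one_pos
  have hL1 : Tendsto (fun ε => ∫ y, |√(fε ε y) - √(f y)| ∂(volume.restrict S)) (𝓝[>] 0) (𝓝 0) := by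
    refine tendsto_integral_abs_of_tendsto_integral_sq ?_ ?_ (hL2loc (2 * R + 1) (by linarith))
    · filter_upwards [hε1] with ε hε
      exact (hfεi ε hε).restrict.real_sqrt.sub hfi.restrict.real_sqrt
    · filter_upwards [hε1] with ε hε
      exact integrable_sq_sqrt_sub_sqrt (hfεi ε hε).restrict hfi.restrict
  have key := tendsto_integral_prod_mul_of_tendsto (μ := volume.restrict S)
    (x := fun ε y => √(fε ε y)) (x₀ := fun y => √(f y))
    (hε1.mono fun ε hε => (hfεi ε hε).restrict.real_sqrt) hfi.restrict.real_sqrt hL1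
    (A := fun ε => grazingOp γ β ψ h i ε) (C := C)
    (Eventually.of_forall fun ε =>
      (measurable_grazingOp hβm hψ.continuous.measurable hhm him ε).aestronglyMeasurable)
    (hε1.mono fun ε hε => hC ε hε.1) hlim
  rw [hprod, setIntegral_eq_integral_of_forall_compl_eq_zero fun q hq => by
    rw [hDfar q (hSfar q hq), mul_zero]] at key
  have hlimit : ∫ q : E3 × E3, √(f q.1) * √(f q.2) * (2 * D q) =
      2 * ∫ q : E3 × E3, √(f q.1 * f q.2) * D q := by
    rw [← integral_const_mul]
    congr 1
    ext q
    rw [sqrt_mul (hf0 _)]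
    ring
  rw [hlimit] at key
  refine key.congr' ?_
  filter_upwards [hε1] with ε hε
  rw [setIntegral_eq_integral_of_forall_compl_eq_zero fun q hq => by
    rw [hfar ε q (hSfar q hq), mul_zero]]
  congr 1
  ext q
  rw [sqrt_mul (hfε0 ε hε _), grazingOp]
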